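/- Assume the initialization y₀ = y₋₁ + Σ(Ax₀ − b^δ). Given ξ > 0 and η > 0, define θ := ξ − τ_M(ξL + σ_M‖A‖²) and ρ := σ_m(η − 1) − σ_Mξη. Then for the primal–dual iterates with data b^δ, for every (x, y) ∈ X × Y and every k ≥ 1: V(z_k − z) + (θ/(2τ_Mξ))∑_{j=1}^k ‖x_j − x_{j−1}‖² + (ρ/(2η))∑_{j=1}^k ‖Ax_j − Ax‖² + ∑_{j=1}^k [L_{b^δ}(x_j, y) − L_{b^δ}(x, y_j)] ≤ V(z₀ − z) + ∑_{j=1}^k ε_j + (σ_m(η − 1)k/2)‖Ax − b^δ‖², where z = (x, y) and z_k = (x_k, y_k). -/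

import Mathlib

open scoped RealInnerProductSpace ENNReal NNReal
open Filter Topology

noncomputable section

/-- The `ε`-subdifferential of an extended-real-valued function `R` at `x`:
`∂_ε R (x) = {u : ∀ x', R x - R x' ≤ ⟪u, x - x'⟫ + ε}`, written without `EReal` subtraction. -/
def epsSubdiff {X : Type*} [NormedAddCommGroup X] [InnerProductSpace ℝ X]
    (R : X → EReal) (ε : ℝ) (x : X) : Set X :=
  {u | ∀ x' : X, R x + ((⟪u, x' - x⟫ - ε : ℝ) : EReal) ≤ R x'}

/-- Convexity for extended-real-valued functions. -/
def ERealConvex {X : Type*} [AddCommGroup X] [Module ℝ X] (R : X → EReal) : Prop :=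
  ∀ x y : X, ∀ t : ℝ, 0 ≤ t → t ≤ 1 →
    R (t • x + (1 - t) • y) ≤ (t : EReal) * R x + ((1 - t : ℝ) : EReal) * R y

/-- `R` is proper, convex and lower semicontinuous. -/
def ProperConvexLsc {X : Type*} [NormedAddCommGroup X] [InnerProductSpace ℝ X]
    (R : X → EReal) : Prop :=
  (∃ x, R x ≠ ⊤) ∧ (∀ x, R x ≠ ⊥) ∧ ERealConvex R ∧ LowerSemicontinuous R

/-- The Lagrangian `L_b(x,y) = R x + F x + ⟪y, A x - b⟫`. -/
def Lag {X Y : Type*} [NormedAddCommGroup X] [InnerProductSpace ℝ X]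
    [NormedAddCommGroup Y] [InnerProductSpace ℝ Y]
    (R : X → EReal) (F : X → ℝ) (A : X →L[ℝ] Y) (b : Y) (x : X) (y : Y) : EReal :=
  R x + ((F x + ⟪y, A x - b⟫ : ℝ) : EReal)

/-- Saddle points of the Lagrangian `L_b`. -/
def IsSaddle {X Y : Type*} [NormedAddCommGroup X] [InnerProductSpace ℝ X]
    [NormedAddCommGroup Y] [InnerProductSpace ℝ Y]
    (R : X → EReal) (F : X → ℝ) (A : X →L[ℝ] Y) (b : Y) (p : X × Y) : Prop :=
  ∀ x : X, ∀ y : Y, Lag R F A b p.1 y ≤ Lag R F A b x p.2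

/-- Weak convergence of a sequence in a Hilbert space. -/
def WeakTendsto {X : Type*} [NormedAddCommGroup X] [InnerProductSpace ℝ X]
    (u : ℕ → X) (l : X) : Prop :=
  ∀ w : X, Tendsto (fun k => ⟪u k, w⟫) atTop (nhds ⟪l, w⟫)

/-- `V(x,y) = ½‖x‖_T² + ½‖y‖_Σ²`, written via the inverses of the preconditioners. -/
def Vfun {X Y : Type*} [NormedAddCommGroup X] [InnerProductSpace ℝ X]
    [NormedAddCommGroup Y] [InnerProductSpace ℝ Y]
    (Tinv : X →L[ℝ] X) (Sginv : Y →L[ℝ] Y) (z : X × Y) : ℝ :=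
  1 / 2 * ⟪Tinv z.1, z.1⟫ + 1 / 2 * ⟪Sginv z.2, z.2⟫

variable {X Y : Type*}
  [NormedAddCommGroup X] [InnerProductSpace ℝ X] [CompleteSpace X]
  [NormedAddCommGroup Y] [InnerProductSpace ℝ Y] [CompleteSpace Y]

section Smooth

variable {E : Type*} [NormedAddCommGroup E] [InnerProductSpace ℝ E] [CompleteSpace E]
  {F : E → ℝ} {g : E}

theorem HasGradientAt.hasDerivAt_comp_add_smul {u h : E} {t : ℝ}
    (hF : HasGradientAt F g (u + t • h)) :
    HasDerivAt (fun s : ℝ => F (u + s • h)) ⟪g, h⟫ t := by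
  have hline : HasDerivAt (fun s : ℝ => u + s • h) h t := by
    simpa using ((hasDerivAt_id t).smul_const h).const_add u
  simpa [Function.comp_def] using hF.hasFDerivAt.comp_hasDerivAt t hline

/-- A convex function lies above its tangent planes. -/
theorem ConvexOn.add_inner_gradient_le {u : E} (hconv : ConvexOn ℝ Set.univ F)
    (hF : HasGradientAt F g u) (v : E) : F u + ⟪g, v - u⟫ ≤ F v := by
  have hc : ConvexOn ℝ Set.univ (fun s : ℝ => F (u + s • (v - u))) := by
    have h := hconv.comp_affineMap (AffineMap.lineMap (k := ℝ) u v)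
    simpa [Function.comp_def, AffineMap.lineMap_apply, add_comm] using h
  have hd : HasDerivAt (fun s : ℝ => F (u + s • (v - u))) ⟪g, v - u⟫ 0 :=
    HasGradientAt.hasDerivAt_comp_add_smul (by simpa using hF)
  have hs := hc.le_slope_of_hasDerivAt (Set.mem_univ 0) (Set.mem_univ 1) zero_lt_one hd
  simp only [slope_def_field, one_smul, zero_smul, add_zero, add_sub_cancel, sub_zero,
    div_one] at hs
  linarith

/-- The descent lemma for functions with Lipschitz gradient. -/
theorem le_add_inner_gradient_add_sq {F' : E → E} {L : ℝ}
    (hF : ∀ u, HasGradientAt F (F' u) u) (hLip : ∀ u v, ‖F' u - F' v‖ ≤ L * ‖u - v‖)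
    (u v : E) : F v ≤ F u + ⟪F' u, v - u⟫ + L / 2 * ‖v - u‖ ^ 2 := by
  set h := v - u with hh
  have hd : ∀ t : ℝ, HasDerivAt
      (fun s : ℝ => F (u + s • h) - s * ⟪F' u, h⟫ - L / 2 * ‖h‖ ^ 2 * s ^ 2)
      (⟪F' (u + t • h), h⟫ - ⟪F' u, h⟫ - L * ‖h‖ ^ 2 * t) t := by
    intro t
    have h1 := (hF (u + t • h)).hasDerivAt_comp_add_smul
    have h2 := (hasDerivAt_id t).mul_const ⟪F' u, h⟫
    have h3 := ((hasDerivAt_id t).pow 2).const_mul (L / 2 * ‖h‖ ^ 2)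
    refine ((h1.sub h2).sub h3).congr_deriv ?_
    simp only [id, Nat.cast_ofNat]
    ring
  have hanti := antitoneOn_of_deriv_nonpos (convex_Icc (0 : ℝ) 1)
    (fun t _ => (hd t).continuousAt.continuousWithinAt)
    (fun t _ => (hd t).differentiableAt.differentiableWithinAt) (by
      intro t ht
      rw [interior_Icc] at ht
      rw [(hd t).deriv, ← inner_sub_left]
      have h1 := real_inner_le_norm (F' (u + t • h) - F' u) h
      have h2 := hLip (u + t • h) u
      rw [add_sub_cancel_left, norm_smul, Real.norm_of_nonneg ht.1.le] at h2
      nlinarith [norm_nonneg h])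
  have h01 := hanti (Set.left_mem_Icc.2 zero_le_one) (Set.right_mem_Icc.2 zero_le_one)
    zero_le_one
  simp only [one_smul, zero_smul, add_zero, hh, add_sub_cancel] at h01
  linarith

end Smooth

section SelfAdjoint

variable {E : Type*} [NormedAddCommGroup E] [InnerProductSpace ℝ E] {S : E →L[ℝ] E}

/-- Three-point identity for the quadratic form of a symmetric operator. -/
theorem inner_map_sub_sub_of_symmetric (hS : ∀ u v : E, ⟪S u, v⟫ = ⟪u, S v⟫) (a b c : E) :
    ⟪S (a - b), c - a⟫
      = 1 / 2 * ⟪S (b - c), b - c⟫ - 1 / 2 * ⟪S (a - c), a - c⟫ - 1 / 2 * ⟪S (a - b), a - b⟫ := by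
  have h : ∀ u v : E, ⟪S u, v⟫ = ⟪S v, u⟫ := fun u v => by rw [hS, real_inner_comm]
  simp only [map_sub, inner_sub_left, inner_sub_right]
  rw [h a b, h a c, h b c]
  ring

/-- Young's inequality for the quadratic form of a symmetric positive operator. -/
theorem inner_map_le_of_symmetric (hS : ∀ u v : E, ⟪S u, v⟫ = ⟪u, S v⟫)
    (hpos : ∀ u, 0 ≤ ⟪S u, u⟫) {ξ : ℝ} (hξ : 0 < ξ) (a b : E) :
    ⟪S a, b⟫ ≤ 1 / (2 * ξ) * ⟪S a, a⟫ + ξ / 2 * ⟪S b, b⟫ := by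
  have h0 := hpos (a - ξ • b)
  have h : ⟪S b, a⟫ = ⟪S a, b⟫ := by rw [hS, real_inner_comm]
  simp only [map_sub, map_smul, inner_sub_left, inner_sub_right, real_inner_smul_left,
    real_inner_smul_right, h] at h0
  have h1 : 1 / (2 * ξ) * ⟪S a, a⟫ + ξ / 2 * ⟪S b, b⟫ - ⟪S a, b⟫
      = (1 / (2 * ξ)) * (⟪S a, a⟫ - ξ * ⟪S a, b⟫ - ξ * (⟪S a, b⟫ - ξ * ⟪S b, b⟫)) := by
    field_simp
    ring
  have h2 : 0 ≤ (1 / (2 * ξ)) * (⟪S a, a⟫ - ξ * ⟪S a, b⟫ - ξ * (⟪S a, b⟫ - ξ * ⟪S b, b⟫)) :=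
    mul_nonneg (by positivity) (by linarith)
  linarith

/-- An upper bound on a positive operator gives a lower bound on its inverse. -/
theorem norm_sq_map_le_of_symmetric (hS : ∀ u v : E, ⟪S u, v⟫ = ⟪u, S v⟫)
    (hpos : ∀ u, 0 ≤ ⟪S u, u⟫) {c : ℝ} (hc : 0 < c) (hle : ∀ u, ⟪S u, u⟫ ≤ c * ‖u‖ ^ 2)
    (w : E) : ‖S w‖ ^ 2 / c ≤ ⟪S w, w⟫ := by
  have h := hpos (w - c⁻¹ • S w)
  have h2 := hle (S w)
  have h3 : ⟪S (S w), w⟫ = ‖S w‖ ^ 2 := by rw [hS, real_inner_self_eq_norm_sq]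
  simp only [map_sub, map_smul, inner_sub_left, inner_sub_right, real_inner_smul_left,
    real_inner_smul_right, real_inner_self_eq_norm_sq, h3] at h
  have h4 : c⁻¹ * (c⁻¹ * ⟪S (S w), S w⟫) ≤ c⁻¹ * (c⁻¹ * (c * ‖S w‖ ^ 2)) := by gcongr
  rw [inv_mul_cancel_left₀ hc.ne'] at h4
  rw [div_eq_inv_mul]
  linarith

end SelfAdjoint

theorem sum_lag_eq_coe {E G ι : Type*} [NormedAddCommGroup E] [InnerProductSpace ℝ E]
    [NormedAddCommGroup G] [InnerProductSpace ℝ G]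
    (R : E → EReal) (F : E → ℝ) (A : E →L[ℝ] G) (b : G) (s : Finset ι) (x : ι → E) (y : ι → G)
    (r : ι → ℝ) (hr : ∀ i ∈ s, R (x i) = (r i : EReal)) :
    ∑ i ∈ s, Lag R F A b (x i) (y i)
      = ((∑ i ∈ s, (r i + (F (x i) + ⟪y i, A (x i) - b⟫)) : ℝ) : EReal) := by
  classical
  induction s using Finset.induction_on with
  | empty => simp
  | insert i s hi ih =>
    rw [Finset.sum_insert hi, Finset.sum_insert hi,
      ih fun j hj => hr j (Finset.mem_insert_of_mem hj), Lag,
      hr i (Finset.mem_insert_self i s)]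
    norm_cast

/-- One step of the iteration, for finite values of the nonsmooth term. -/
theorem primal_dual_step_le
    (A : X →L[ℝ] Y) (b : Y) (F : X → ℝ) (F' : X → X) (L : ℝ)
    (hFconv : ConvexOn ℝ Set.univ F)
    (hFgrad : ∀ u : X, HasGradientAt F (F' u) u)
    (hFlip : ∀ u v : X, ‖F' u - F' v‖ ≤ L * ‖u - v‖)
    (T Tinv : X →L[ℝ] X) (Sg Sginv : Y →L[ℝ] Y)
    (hTinv' : ∀ u, T (Tinv u) = u)
    (hSginv : ∀ v, Sginv (Sg v) = v) (hSginv' : ∀ v, Sg (Sginv v) = v)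
    (hTsa : ∀ u v : X, ⟪T u, v⟫ = ⟪u, T v⟫)
    (hSgsa : ∀ u v : Y, ⟪Sg u, v⟫ = ⟪u, Sg v⟫)
    {τM σm σM : ℝ} (hτM : 0 < τM) (hσm : 0 < σm) (hσM : 0 < σM)
    (hTb : ∀ u : X, 0 ≤ ⟪T u, u⟫ ∧ ⟪T u, u⟫ ≤ τM * ‖u‖ ^ 2)
    (hSgb : ∀ v : Y, σm * ‖v‖ ^ 2 ≤ ⟪Sg v, v⟫ ∧ ⟪Sg v, v⟫ ≤ σM * ‖v‖ ^ 2)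
    {ξ η : ℝ} (hξ : 0 < ξ) (hη : 0 < η)
    {e r rp : ℝ} {x x' p : X} {y y' yt q : Y}
    (hsub : r + (⟪-(Tinv (x' - x)) - F' x - ContinuousLinearMap.adjoint A yt, p - x'⟫ - e) ≤ rp)
    (hy' : y' = y + Sg (A x' - b)) (hyt : y' - yt = Sg (A (x' - x))) :
    Vfun Tinv Sginv (x' - p, y' - q)
      + (ξ - τM * (ξ * L + σM * ‖A‖ ^ 2)) / (2 * τM * ξ) * ‖x' - x‖ ^ 2
      + (σm * (η - 1) - σM * ξ * η) / (2 * η) * ‖A x' - A p‖ ^ 2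
      + (r + (F x' + ⟪q, A x' - b⟫))
    ≤ Vfun Tinv Sginv (x - p, y - q) + e + σm * (η - 1) / 2 * ‖A p - b‖ ^ 2
      + (rp + (F p + ⟪y', A p - b⟫)) := by
  have hTisa : ∀ u v : X, ⟪Tinv u, v⟫ = ⟪u, Tinv v⟫ := fun u v => by
    conv_lhs => rw [← hTinv' v]
    rw [← hTsa, hTinv']
  have hSisa : ∀ u v : Y, ⟪Sginv u, v⟫ = ⟪u, Sginv v⟫ := fun u v => by
    conv_lhs => rw [← hSginv' v]
    rw [← hSgsa, hSginv']
  have hSpos : ∀ v : Y, 0 ≤ ⟪Sg v, v⟫ := fun v => le_trans (by positivity) (hSgb v).1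
  have hprimal := inner_map_sub_sub_of_symmetric hTisa x' x p
  have hdual := inner_map_sub_sub_of_symmetric hSisa y' y q
  have hd : y' - y = Sg (A x' - b) := by rw [hy']; abel
  rw [hd, hSginv] at hdual
  have hconv := hFconv.add_inner_gradient_le (hFgrad x) p
  have hdesc := le_add_inner_gradient_add_sq hFgrad hFlip x x'
  have hTlow : ‖x' - x‖ ^ 2 / τM ≤ ⟪Tinv (x' - x), x' - x⟫ := by
    have h := norm_sq_map_le_of_symmetric hTsa (fun u => (hTb u).1) hτM (fun u => (hTb u).2)
      (Tinv (x' - x))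
    rwa [hTinv', real_inner_comm] at h
  have hyoung := inner_map_le_of_symmetric hSgsa hSpos hξ (A (x' - x)) (A (x' - p))
  have hb1 : ⟪Sg (A (x' - x)), A (x' - x)⟫ ≤ σM * ‖A‖ ^ 2 * ‖x' - x‖ ^ 2 := by
    refine (hSgb _).2.trans ?_
    rw [mul_assoc, ← mul_pow]
    gcongr
    exact A.le_opNorm _
  have hb2 := (hSgb (A (x' - p))).2
  have hb3 : σm * ((1 - 1 / η) * ‖A (x' - p)‖ ^ 2 + (1 - η) * ‖A p - b‖ ^ 2)
      ≤ ⟪A x' - b, Sg (A x' - b)⟫ := by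
    rw [real_inner_comm]
    refine le_trans (mul_le_mul_of_nonneg_left ?_ hσm.le) (hSgb _).1
    have hab : A x' - b = A (x' - p) + (A p - b) := by rw [map_sub]; abel
    rw [hab, norm_add_sq_real]
    have h0 : 0 ≤ 1 / η * ‖A (x' - p) + η • (A p - b)‖ ^ 2 := by positivity
    rw [norm_add_sq_real, real_inner_smul_right, norm_smul, mul_pow,
      Real.norm_of_nonneg hη.le] at h0
    have h1 : 1 / η * (‖A (x' - p)‖ ^ 2 + 2 * (η * ⟪A (x' - p), A p - b⟫)
        + η ^ 2 * ‖A p - b‖ ^ 2) = 1 / η * ‖A (x' - p)‖ ^ 2 + 2 * ⟪A (x' - p), A p - b⟫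
        + η * ‖A p - b‖ ^ 2 := by
      field_simp
    linarith
  have hyt' : yt = y' - Sg (A (x' - x)) := by rw [← hyt]; abel
  rw [inner_sub_left, inner_sub_left, inner_neg_left, ContinuousLinearMap.adjoint_inner_left,
    hyt', inner_sub_left] at hsub
  have hy1 : ⟪y', A (p - x')⟫ = ⟪y', A p - b⟫ - ⟪y', A x' - b⟫ := by
    rw [← inner_sub_right, map_sub]; congr 1; abel
  have hy2 : ⟪Sg (A (x' - x)), A (p - x')⟫ = -⟪Sg (A (x' - x)), A (x' - p)⟫ := by
    rw [← inner_neg_right, ← map_neg, neg_sub]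
  have hy3 : ⟪A x' - b, q - y'⟫ = ⟪q, A x' - b⟫ - ⟪y', A x' - b⟫ := by
    rw [← inner_sub_left, real_inner_comm]
  have hF : ⟪F' x, p - x'⟫ = ⟪F' x, p - x⟫ - ⟪F' x, x' - x⟫ := by
    rw [← inner_sub_right]; congr 1; abel
  have hA : A x' - A p = A (x' - p) := (map_sub A x' p).symm
  have hθ : (ξ - τM * (ξ * L + σM * ‖A‖ ^ 2)) / (2 * τM * ξ) * ‖x' - x‖ ^ 2
      = 1 / 2 * (‖x' - x‖ ^ 2 / τM) - L / 2 * ‖x' - x‖ ^ 2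
        - 1 / (2 * ξ) * (σM * ‖A‖ ^ 2 * ‖x' - x‖ ^ 2) := by
    field_simp
    ring
  have hρ : (σm * (η - 1) - σM * ξ * η) / (2 * η) * ‖A (x' - p)‖ ^ 2
      = 1 / 2 * (σm * ((1 - 1 / η) * ‖A (x' - p)‖ ^ 2))
        - ξ / 2 * (σM * ‖A (x' - p)‖ ^ 2) := by
    field_simp
  have hb1' := mul_le_mul_of_nonneg_left hb1 (show 0 ≤ 1 / (2 * ξ) by positivity)
  have hb2' := mul_le_mul_of_nonneg_left hb2 (show 0 ≤ ξ / 2 by positivity)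
  rw [hA, hθ, hρ]
  simp only [Vfun]
  linarith

/-- Second cumulative estimate (with initialization
`y₀ = y₋₁ + Σ(Ax₀ - b^δ)`, `θ = ξ - τ_M(ξL + σ_M‖A‖²)` and `ρ = σ_m(η-1) - σ_Mξη`):
for all `(x, y)` and `k ≥ 1`,
`V(z_k - z) + (θ/(2τ_Mξ)) Σ‖x_j - x_{j-1}‖² + (ρ/(2η)) Σ‖Ax_j - Ax‖²
 + Σ [L_{b^δ}(x_j,y) - L_{b^δ}(x,y_j)] ≤ V(z₀ - z) + Σ ε_j + (σ_m(η-1)k/2)‖Ax - b^δ‖²`. -/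
theorem statement_14
    (A : X →L[ℝ] Y) (bδ : Y)
    (R : X → EReal) (hR : ProperConvexLsc R)
    (F : X → ℝ) (F' : X → X) (L : ℝ) (hL : 0 ≤ L)
    (hFconv : ConvexOn ℝ Set.univ F)
    (hFgrad : ∀ u : X, HasGradientAt F (F' u) u)
    (hFlip : ∀ u v : X, ‖F' u - F' v‖ ≤ L * ‖u - v‖)
    (T Tinv : X →L[ℝ] X) (Sg Sginv : Y →L[ℝ] Y)
    (hTinv : ∀ u, Tinv (T u) = u) (hTinv' : ∀ u, T (Tinv u) = u)
    (hSginv : ∀ v, Sginv (Sg v) = v) (hSginv' : ∀ v, Sg (Sginv v) = v)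
    (hTsa : ∀ u v : X, ⟪T u, v⟫ = ⟪u, T v⟫)
    (hSgsa : ∀ u v : Y, ⟪Sg u, v⟫ = ⟪u, Sg v⟫)
    (τm τM σm σM : ℝ) (hτm : 0 < τm) (hττ : τm ≤ τM) (hσm : 0 < σm) (hσσ : σm ≤ σM)
    (hTb : ∀ u : X, τm * ‖u‖ ^ 2 ≤ ⟪T u, u⟫ ∧ ⟪T u, u⟫ ≤ τM * ‖u‖ ^ 2)
    (hSgb : ∀ v : Y, σm * ‖v‖ ^ 2 ≤ ⟪Sg v, v⟫ ∧ ⟪Sg v, v⟫ ≤ σM * ‖v‖ ^ 2)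
    (ξ η : ℝ) (hξ : 0 < ξ) (hη : 0 < η)
    (ε : ℕ → ℝ) (hε : ∀ k, 0 ≤ ε k)
    (x : ℕ → X) (y : ℕ → Y) (ym1 : Y)
    (hinit : y 0 = ym1 + Sg (A (x 0) - bδ))
    (hstep : ∀ k : ℕ,
      -(Tinv (x (k + 1) - x k)) - F' (x k)
          - ContinuousLinearMap.adjoint A ((2 : ℝ) • y k - (if k = 0 then ym1 else y (k - 1)))
        ∈ epsSubdiff R (ε (k + 1)) (x (k + 1)))
    (hdual : ∀ k : ℕ, y (k + 1) = y k + Sg (A (x (k + 1)) - bδ)) :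
    ∀ px : X, ∀ py : Y, ∀ k : ℕ, 1 ≤ k →
      ((Vfun Tinv Sginv (x k - px, y k - py)
          + (ξ - τM * (ξ * L + σM * ‖A‖ ^ 2)) / (2 * τM * ξ)
              * ∑ j ∈ Finset.Icc 1 k, ‖x j - x (j - 1)‖ ^ 2
          + (σm * (η - 1) - σM * ξ * η) / (2 * η)
              * ∑ j ∈ Finset.Icc 1 k, ‖A (x j) - A px‖ ^ 2 : ℝ) : EReal)
          + ∑ j ∈ Finset.Icc 1 k, Lag R F A bδ (x j) py
        ≤ ((Vfun Tinv Sginv (x 0 - px, y 0 - py) + ∑ j ∈ Finset.Icc 1 k, ε j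
            + σm * (η - 1) * k / 2 * ‖A px - bδ‖ ^ 2 : ℝ) : EReal)
          + ∑ j ∈ Finset.Icc 1 k, Lag R F A bδ px (y j) := by
  intro px py k hk
  have hτM : 0 < τM := hτm.trans_le hττ
  have hσM : 0 < σM := hσm.trans_le hσσ
  obtain ⟨⟨x₀, hx₀⟩, hbot, -, -⟩ := hR
  have hfin : ∀ j ∈ Finset.Icc 1 k, R (x j) = ((R (x j)).toReal : EReal) := by
    intro j hj
    obtain ⟨i, rfl⟩ : ∃ i, j = i + 1 := ⟨j - 1, by have := (Finset.mem_Icc.1 hj).1; omega⟩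
    refine (EReal.coe_toReal (fun htop => hx₀ ?_) (hbot _)).symm
    have h := hstep i x₀
    rw [htop, EReal.top_add_coe] at h
    exact top_le_iff.1 h
  by_cases hp : R px = ⊤
  · have hlag : ∀ v : Y, Lag R F A bδ px v = ⊤ := fun v => by
      rw [Lag, hp, EReal.top_add_coe]
    have hsum : ∀ n : ℕ, 1 ≤ n → ∑ j ∈ Finset.Icc 1 n, Lag R F A bδ px (y j) = ⊤ := by
      intro n hn
      induction n, hn using Nat.le_induction with
      | base => simp [hlag]
      | succ n hn ih => rw [Finset.sum_Icc_succ_top (by omega), ih, hlag, EReal.top_add_top]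
    rw [hsum k hk, EReal.coe_add_top]
    exact le_top
  have hpx : R px = ((R px).toReal : EReal) := (EReal.coe_toReal hp (hbot _)).symm
  rw [sum_lag_eq_coe R F A bδ _ x (fun _ => py) (fun j => (R (x j)).toReal) hfin,
    sum_lag_eq_coe R F A bδ _ (fun _ => px) y (fun _ => (R px).toReal) (fun _ _ => hpx),
    ← EReal.coe_add, ← EReal.coe_add, EReal.coe_le_coe_iff]
  have hind : ∀ n : ℕ, n ≤ k →
      Vfun Tinv Sginv (x n - px, y n - py)
          + (ξ - τM * (ξ * L + σM * ‖A‖ ^ 2)) / (2 * τM * ξ)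
              * ∑ j ∈ Finset.Icc 1 n, ‖x j - x (j - 1)‖ ^ 2
          + (σm * (η - 1) - σM * ξ * η) / (2 * η)
              * ∑ j ∈ Finset.Icc 1 n, ‖A (x j) - A px‖ ^ 2
          + ∑ j ∈ Finset.Icc 1 n, ((R (x j)).toReal + (F (x j) + ⟪py, A (x j) - bδ⟫))
        ≤ Vfun Tinv Sginv (x 0 - px, y 0 - py) + ∑ j ∈ Finset.Icc 1 n, ε j
            + σm * (η - 1) * n / 2 * ‖A px - bδ‖ ^ 2
          + ∑ j ∈ Finset.Icc 1 n, ((R px).toReal + (F px + ⟪y j, A px - bδ⟫)) := by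
    intro n
    induction n with
    | zero => simp
    | succ n ih =>
      intro hn
      have hyt : y (n + 1) - ((2 : ℝ) • y n - (if n = 0 then ym1 else y (n - 1)))
          = Sg (A (x (n + 1) - x n)) := by
        have hn' : y n = (if n = 0 then ym1 else y (n - 1)) + Sg (A (x n) - bδ) := by
          cases n with
          | zero => simpa using hinit
          | succ m => simpa using hdual m
        generalize (if n = 0 then ym1 else y (n - 1)) = w at hn'
        have hsplit : A (x (n + 1) - x n) = (A (x (n + 1)) - bδ) - (A (x n) - bδ) := by
          rw [map_sub]; abel
        rw [hsplit, map_sub, hdual n, two_smul, hn']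
        abel
      have hsub := hstep n px
      rw [hfin (n + 1) (Finset.mem_Icc.2 ⟨by omega, hn⟩), hpx, ← EReal.coe_add,
        EReal.coe_le_coe_iff] at hsub
      have hone := primal_dual_step_le A bδ F F' L hFconv hFgrad hFlip T Tinv Sg Sginv hTinv'
        hSginv hSginv' hTsa hSgsa hτM hσm hσM
        (fun u => ⟨le_trans (by positivity) (hTb u).1, (hTb u).2⟩) hSgb hξ hη
        (q := py) hsub (hdual n) hyt
      simp only [Finset.sum_Icc_succ_top (show 1 ≤ n + 1 by omega), Nat.add_sub_cancel,
        Nat.cast_add, Nat.cast_one]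
      linarith [ih (by omega)]
  exact hind k le_rfl
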